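/- arXiv:1905.04731 — 2 statements merged into one kernel-verified Lean document; each statement's English description precedes it below -/
import Mathlib

section
/- Let (R, m, k) be a commutative Noetherian local ring with m² = 0 and dim_k(m) ≥ 2 (equivalently, R is Artinian local with m² = 0 and R is not Gorenstein). If a finitely generated R-module M has finite reducing Gorenstein dimension, then M ≅ R^{⊕α} ⊕ k^{⊕β} for some integers α, β ≥ 0. -/
open CategoryTheory

universe u

variable (R : Type u) [CommRing R]

/-- `SES R A B C` : there is a short exact sequence `0 → A → B → C → 0` of `R`-modules. -/
def SES (A B C : ModuleCat.{u} R) : Prop :=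
  ∃ (f : A →ₗ[R] B) (g : B →ₗ[R] C),
    Function.Injective f ∧ Function.Surjective g ∧ LinearMap.range f = LinearMap.ker g

/-- A finitely generated free module. -/
def IsFinFree (F : ModuleCat.{u} R) : Prop :=
  Module.Finite R F ∧ Module.Free R F

/-- `IsSyzygy R n S K` : `S` is an `n`-th syzygy of `K`, i.e. there is an exact sequence
`0 → S → F_{n-1} → ⋯ → F_0 → K → 0` with each `F_j` finitely generated free
(for `n = 0` this just means `S ≅ K`). -/
def IsSyzygy : ℕ → ModuleCat.{u} R → ModuleCat.{u} R → Prop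
  | 0, S, K => Nonempty (S ≃ₗ[R] K)
  | n + 1, S, K => ∃ T F : ModuleCat.{u} R, IsSyzygy n T K ∧ IsFinFree R F ∧ SES R S F T

/-- The direct sum `M^{⊕ a}`. -/
def MPow (M : ModuleCat.{u} R) (a : ℕ) : ModuleCat.{u} R := ModuleCat.of R (Fin a → M)

/-- `IsReducingSeq R K` : the finitely generated modules `K 0, …, K r` form a reducing
sequence, i.e. there are positive integers `a i, b i, n i` and short exact sequences
`0 → (K i)^{⊕ a i} → K (i+1) → S i → 0` where `S i` is an `(n i)`-th syzygy
of `(K i)^{⊕ b i}`. -/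
def IsReducingSeq {r : ℕ} (K : Fin (r + 1) → ModuleCat.{u} R) : Prop :=
  (∀ i, Module.Finite R (K i)) ∧
  ∃ a b n : Fin r → ℕ,
    (∀ i, 0 < a i) ∧ (∀ i, 0 < b i) ∧ (∀ i, 0 < n i) ∧
    ∀ i : Fin r, ∃ S : ModuleCat.{u} R,
      IsSyzygy R (n i) S (MPow R (K i.castSucc) (b i)) ∧
      SES R (MPow R (K i.castSucc) (a i)) (K i.succ) S

/-- `ExtVanishes R M N i` : the `R`-module `Ext^i_R(M, N)` is zero. -/
def ExtVanishes (M N : ModuleCat.{u} R) (i : ℕ) : Prop :=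
  Subsingleton (((Ext R (ModuleCat.{u} R) i).obj (Opposite.op M)).obj N)

/-- A totally reflexive module. -/
def IsTotallyReflexive (M : ModuleCat.{u} R) : Prop :=
  Function.Bijective (Module.Dual.eval R M) ∧
  ∀ i : ℕ, 1 ≤ i →
    ExtVanishes R M (ModuleCat.of R R) i ∧
    ExtVanishes R (ModuleCat.of R (Module.Dual R M)) (ModuleCat.of R R) i

/-- `ResolvedBy R P m M` : there is an exact sequence `0 → G_m → ⋯ → G_0 → M → 0`
in which each `G_j` satisfies `P`. -/
def ResolvedBy (P : ModuleCat.{u} R → Prop) : ℕ → ModuleCat.{u} R → Prop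
  | 0, M => ∃ G : ModuleCat.{u} R, P G ∧ Nonempty (G ≃ₗ[R] M)
  | m + 1, M => ∃ G S : ModuleCat.{u} R, P G ∧ SES R S G M ∧ ResolvedBy P m S

/-- Finite Gorenstein dimension. -/
def FiniteGdim (M : ModuleCat.{u} R) : Prop :=
  ∃ m : ℕ, ResolvedBy R (IsTotallyReflexive R) m M

/-- Finite projective dimension. -/
def FinitePd (M : ModuleCat.{u} R) : Prop :=
  ∃ m : ℕ, ResolvedBy R (fun G => Module.Projective R G) m M

/-- `HasRedSeqTo R P M` : `M` admits a reducing sequence `K_0 = M, K_1, …, K_r`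
whose last module `K_r` satisfies `P`. -/
def HasRedSeqTo (P : ModuleCat.{u} R → Prop) (M : ModuleCat.{u} R) : Prop :=
  ∃ (r : ℕ) (K : Fin (r + 1) → ModuleCat.{u} R),
    K 0 = M ∧ IsReducingSeq R K ∧ P (K (Fin.last r))

/-- Finite reducing Gorenstein dimension. -/
def FiniteRedGdim (M : ModuleCat.{u} R) : Prop :=
  HasRedSeqTo R (FiniteGdim R) M

/-- Finite reducing projective dimension. -/
def FiniteRedPd (M : ModuleCat.{u} R) : Prop :=
  HasRedSeqTo R (FinitePd R) M

open IsLocalRing in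
/-- A nonzero element of the maximal ideal is detected by a functional to the residue field. -/
theorem aux_functional (R : Type u) [CommRing R] [IsNoetherianRing R] [IsLocalRing R]
    (hm2 : (maximalIdeal R) ^ 2 = ⊥) (x : maximalIdeal R) (hx : x ≠ 0) :
    ∃ l : maximalIdeal R →ₗ[R] ResidueField R, l x = 1 := by
  have h0 : (maximalIdeal R).toCotangent x ≠ 0 := by
    intro h
    rw [Ideal.toCotangent_eq_zero, hm2] at h
    exact hx (Subtype.ext (by simpa using h))
  obtain ⟨f, hf⟩ := Module.Projective.exists_dual_eq_one (ResidueField R)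
    (V := CotangentSpace R) h0
  exact ⟨(f.restrictScalars R) ∘ₗ (maximalIdeal R).toCotangent, hf⟩

theorem aux_mul (R : Type u) [CommRing R] [IsLocalRing R]
    (hm2 : (IsLocalRing.maximalIdeal R) ^ 2 = ⊥) {x y : R}
    (hx : x ∈ IsLocalRing.maximalIdeal R) (hy : y ∈ IsLocalRing.maximalIdeal R) : x * y = 0 := by
  have := Ideal.mul_mem_mul hx hy
  rw [← pow_two, hm2] at this
  simpa using this

open IsLocalRing in
theorem aux_smul_res (R : Type u) [CommRing R] [IsLocalRing R] {a : R}
    (ha : a ∈ maximalIdeal R) (z : ResidueField R) : a • z = 0 := by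
  rw [Algebra.smul_def]
  have : algebraMap R (ResidueField R) a = 0 := (residue_eq_zero_iff a).2 ha
  rw [this, zero_mul]

open IsLocalRing in
theorem aux_noext (R : Type u) [CommRing R] [IsNoetherianRing R] [IsLocalRing R]
    (hm2 : (maximalIdeal R) ^ 2 = ⊥)
    (he : 2 ≤ Module.finrank (ResidueField R) (CotangentSpace R))
    (h : ∀ φ : maximalIdeal R →ₗ[R] R, ∃ r : R, ∀ z : maximalIdeal R, φ z = r * z) : False := by
  by_cases h0 : ∃ x : maximalIdeal R, x ≠ 0
  · obtain ⟨x, hx⟩ := h0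
    obtain ⟨l, hl⟩ := aux_functional R hm2 x hx
    have : Module.finrank (ResidueField R) (CotangentSpace R) ≤ 1 := by
      refine finrank_le_one ((maximalIdeal R).toCotangent x) fun w => ?_
      obtain ⟨y, rfl⟩ := (maximalIdeal R).toCotangent_surjective w
      let κ : ResidueField R →ₗ[R] R :=
        (maximalIdeal R).liftQ (LinearMap.toSpanSingleton R R (y : R)) (by
          intro a ha
          simpa using aux_mul R hm2 ha y.2)
      have hκ : κ 1 = y := by
        have : κ 1 = (1 : R) • (y : R) := rfl
        simpa using this
      obtain ⟨r, hr⟩ := h (κ ∘ₗ l)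
      have h1 := hr x
      simp only [LinearMap.comp_apply, hl, hκ] at h1
      refine ⟨residue R r, ?_⟩
      have : y = r • x := Subtype.ext h1
      rw [this, map_smul]
      rfl
    omega
  · push Not at h0
    have : Module.finrank (ResidueField R) (CotangentSpace R) ≤ 1 := by
      refine finrank_le_one 0 fun w => ?_
      obtain ⟨y, rfl⟩ := (maximalIdeal R).toCotangent_surjective w
      exact ⟨0, by rw [h0 y]; simp⟩
    omega

open IsLocalRing in
theorem aux_exists_ne (R : Type u) [CommRing R] [IsNoetherianRing R] [IsLocalRing R]
    (hm2 : (maximalIdeal R) ^ 2 = ⊥)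
    (he : 2 ≤ Module.finrank (ResidueField R) (CotangentSpace R)) :
    ∃ y ∈ maximalIdeal R, y ≠ 0 := by
  by_contra! h0
  refine aux_noext R hm2 he fun φ => ⟨0, fun z => ?_⟩
  have : z = 0 := Subtype.ext (h0 z z.2)
  simp [this]

open IsLocalRing in
/-- Minimal free covers. -/
theorem aux_cover (R : Type u) [CommRing R] [IsLocalRing R]
    (hm2 : (maximalIdeal R) ^ 2 = ⊥) (M : Type u) [AddCommGroup M] [Module R M] :
    ∃ (I : Type u) (q : (I →₀ R) →ₗ[R] M), Function.Surjective q ∧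
      ∀ x, q x = 0 → ∀ i, x i ∈ maximalIdeal R := by
  set m := maximalIdeal R with hm
  let _ : Field (R ⧸ m) := Ideal.Quotient.field m
  let V := M ⧸ (m • ⊤ : Submodule R M)
  let b := Module.Basis.ofVectorSpace (R ⧸ m) V
  let I := Module.Basis.ofVectorSpaceIndex (R ⧸ m) V
  have hs : Function.Surjective (m • ⊤ : Submodule R M).mkQ := Submodule.mkQ_surjective _
  choose g hg using fun i : I => hs (b i)
  let q := Finsupp.linearCombination R g
  have hq : ∀ x : I →₀ R, (m • ⊤ : Submodule R M).mkQ (q x) =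
      Finsupp.linearCombination (R ⧸ m) b (x.mapRange (Ideal.Quotient.mk m) (map_zero _)) := by
    intro x
    simp only [q, Finsupp.linearCombination_apply, map_finsuppSum, map_smul, hg]
    rw [Finsupp.sum_mapRange_index (by simp)]
    rfl
  refine ⟨I, q, ?_, ?_⟩
  · have key : ∀ x : M, ∃ y, x - q y ∈ (m • ⊤ : Submodule R M) := by
      intro x
      let c := b.repr ((m • ⊤ : Submodule R M).mkQ x)
      obtain ⟨y, hy⟩ := Finsupp.mapRange_surjective (Ideal.Quotient.mk m) (map_zero _)
        Ideal.Quotient.mk_surjective c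
      refine ⟨y, ?_⟩
      rw [← Submodule.ker_mkQ (m • ⊤ : Submodule R M), LinearMap.mem_ker, map_sub, hq, hy,
        b.linearCombination_repr, sub_self]
    have hz : ∀ a ∈ m, ∀ y ∈ (m • ⊤ : Submodule R M), a • y = 0 := by
      intro a ha y hy
      refine Submodule.smul_induction_on hy ?_ ?_
      · intro r hr n _
        rw [smul_smul, aux_mul R hm2 ha hr, zero_smul]
      · intro u v hu hv
        rw [smul_add, hu, hv, add_zero]
    have hle : (m • ⊤ : Submodule R M) ≤ LinearMap.range q := by
      rw [Submodule.smul_le]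
      intro a ha x _
      obtain ⟨y, hy⟩ := key x
      have := hz a ha _ hy
      rw [smul_sub, sub_eq_zero] at this
      exact ⟨a • y, by rw [map_smul, this]⟩
    intro x
    obtain ⟨y, hy⟩ := key x
    obtain ⟨w, hw⟩ := hle hy
    exact ⟨y + w, by rw [map_add, hw]; abel⟩
  · intro x hx i
    have h1 := hq x
    rw [hx, map_zero] at h1
    have h2 := (linearIndependent_iff.1 b.linearIndependent) _ h1.symm
    have h3 := DFunLike.congr_fun h2 i
    simpa [Ideal.Quotient.eq_zero_iff_mem] using h3

open IsLocalRing in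
/-- Either `M` is free or the residue field is a retract of any first syzygy of `M`. -/
theorem aux_retract (R : Type u) [CommRing R] [IsNoetherianRing R] [IsLocalRing R]
    (hm2 : (maximalIdeal R) ^ 2 = ⊥) (M P : Type u) [AddCommGroup M] [Module R M]
    [AddCommGroup P] [Module R P] [Module.Projective R P] (π : P →ₗ[R] M)
    (hπ : Function.Surjective π) :
    Module.Free R M ∨ ∃ v : LinearMap.ker π, (∀ a ∈ maximalIdeal R, a • v = 0) ∧
      ∃ t : LinearMap.ker π →ₗ[R] ResidueField R, t v = 1 := by
  obtain ⟨I, q, hq, hmin⟩ := aux_cover R hm2 M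
  by_cases hinj : ∀ x, q x = 0 → x = 0
  · left
    have : Function.Injective q := (injective_iff_map_eq_zero q).2 hinj
    exact Module.Free.of_equiv (LinearEquiv.ofBijective q ⟨this, hq⟩)
  · right
    push Not at hinj
    obtain ⟨v0, hv0, hne⟩ := hinj
    obtain ⟨α, hα⟩ := Module.projective_lifting_property π q hπ
    obtain ⟨β, hβ⟩ := Module.projective_lifting_property q π hq
    have hα' : ∀ x, π (α x) = q x := fun x => LinearMap.congr_fun hα x
    have hβ' : ∀ x, q (β x) = π x := fun x => LinearMap.congr_fun hβ x
    obtain ⟨i, hi⟩ : ∃ i, v0 i ≠ 0 := by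
      by_contra! h
      exact hne (Finsupp.ext h)
    -- a map which is zero mod the maximal ideal kills `v0`
    have hh : ∀ h : (I →₀ R) →ₗ[R] (I →₀ R), (∀ x j, h x j ∈ maximalIdeal R) → h v0 = 0 := by
      intro h hm
      have : v0 = v0.sum fun j a => a • Finsupp.single j (1 : R) := by
        conv_lhs => rw [← Finsupp.sum_single v0]
        simp
      rw [this, map_finsuppSum]
      refine Finset.sum_eq_zero fun j _ => ?_
      change h (v0 j • Finsupp.single j (1 : R)) = 0
      rw [map_smul]
      ext l
      simpa using aux_mul R hm2 (hmin v0 hv0 j) (hm _ l)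
    have hret : β (α v0) = v0 := by
      have := hh (β ∘ₗ α - LinearMap.id) (fun x j => hmin _ (by simp [hβ', hα']) j)
      simpa [sub_eq_zero] using this
    refine ⟨⟨α v0, by rw [LinearMap.mem_ker, hα', hv0]⟩, ?_, ?_⟩
    · intro a ha
      apply Subtype.ext
      have : a • v0 = 0 := by
        ext j
        simpa using aux_mul R hm2 ha (hmin v0 hv0 j)
      simp [← map_smul, this]
    · obtain ⟨l, hl⟩ := aux_functional R hm2 ⟨v0 i, hmin v0 hv0 i⟩
        (fun h => hi (congrArg Subtype.val h))
      let c : LinearMap.ker π →ₗ[R] maximalIdeal R :=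
        LinearMap.codRestrict (maximalIdeal R)
          ((Finsupp.lapply i) ∘ₗ β ∘ₗ (LinearMap.ker π).subtype)
          (fun x => hmin (β x) (by rw [hβ']; exact x.2) i)
      refine ⟨l ∘ₗ c, ?_⟩
      rw [LinearMap.comp_apply, ← hl]
      congr 1
      apply Subtype.ext
      change (β (α v0)) i = v0 i
      rw [hret]

open IsLocalRing in
/-- Extraction of concrete data from the vanishing of `Ext²`. -/
theorem aux_ext (R : Type u) [CommRing R] (G : ModuleCat.{u} R)
    (h : ExtVanishes R G (ModuleCat.of R R) 2) :
    ∃ (P₁ P₀ : Type u) (_ : AddCommGroup P₁) (_ : Module R P₁) (_ : AddCommGroup P₀)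
      (_ : Module R P₀) (_ : Module.Projective R P₁) (_ : Module.Projective R P₀)
      (d : P₁ →ₗ[R] P₀) (π : P₀ →ₗ[R] G), Function.Surjective π ∧
      LinearMap.range d = LinearMap.ker π ∧
      ∀ φ : LinearMap.ker d →ₗ[R] R, ∃ ψ : P₁ →ₗ[R] R, ∀ z : LinearMap.ker d, ψ z = φ z := by
  let P := projectiveResolution G
  have hproj : ∀ n, Module.Projective R (P.complex.X n) := fun n =>
    (IsProjective.iff_projective (R := R) (P.complex.X n)).2 (P.projective n)
  refine ⟨P.complex.X 1, P.complex.X 0, inferInstance, inferInstance, inferInstance,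
    inferInstance, hproj 1, hproj 0, (P.complex.d 1 0).hom, (P.π.f 0).hom, ?_, ?_, ?_⟩
  · exact (ModuleCat.epi_iff_surjective (P.π.f 0)).1 inferInstance
  · exact P.exact₀.moduleCat_range_eq_ker
  · intro φ
    have e21 : LinearMap.range (P.complex.d 2 1).hom = LinearMap.ker (P.complex.d 1 0).hom :=
      (P.exact_succ 0).moduleCat_range_eq_ker
    have hz : Limits.IsZero ((P.complex.linearYonedaObj R (ModuleCat.of R R)).homology 2) := by
      have h' : Subsingleton (((Ext R (ModuleCat.{u} R) 2).obj (Opposite.op G)).obj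
        (ModuleCat.of R R)) := h
      exact Limits.IsZero.of_iso (ModuleCat.isZero_of_subsingleton _)
        (P.isoExt (R := R) 2 (ModuleCat.of R R)).symm
    rw [← HomologicalComplex.exactAt_iff_isZero_homology,
      HomologicalComplex.exactAt_iff' _ 1 2 3 (by simp) (by simp)] at hz
    rw [ShortComplex.moduleCat_exact_iff] at hz
    have hd : ∀ x, (P.complex.d 2 1).hom x ∈ LinearMap.ker (P.complex.d 1 0).hom := by
      intro x
      rw [← e21]
      exact ⟨x, rfl⟩
    let d' := LinearMap.codRestrict _ (P.complex.d 2 1).hom hd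
    have hdd : ∀ x, (P.complex.d 2 1).hom ((P.complex.d 3 2).hom x) = 0 := by
      intro x
      exact LinearMap.congr_fun (congrArg ModuleCat.Hom.hom (P.complex.d_comp_d 3 2 1)) x
    let f : P.complex.X 2 ⟶ ModuleCat.of R R := ModuleCat.ofHom (φ ∘ₗ d')
    have hf : P.complex.d 3 2 ≫ f = 0 := by
      ext x
      change φ (d' ((P.complex.d 3 2).hom x)) = 0
      have : d' ((P.complex.d 3 2).hom x) = 0 := Subtype.ext (hdd x)
      rw [this, map_zero]
    obtain ⟨ψ, hψ⟩ := hz f hf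
    have hψ' : P.complex.d 2 1 ≫ (show P.complex.X 1 ⟶ ModuleCat.of R R from ψ) = f := hψ
    refine ⟨ModuleCat.Hom.hom (show P.complex.X 1 ⟶ ModuleCat.of R R from ψ), ?_⟩
    rintro ⟨z, hz⟩
    have hz' := hz
    rw [← e21] at hz'
    obtain ⟨y, rfl⟩ := hz'
    exact LinearMap.congr_fun (congrArg ModuleCat.Hom.hom hψ') y

open IsLocalRing in
theorem aux_free_of_ext (R : Type u) [CommRing R] [IsNoetherianRing R] [IsLocalRing R]
    (hm2 : (maximalIdeal R) ^ 2 = ⊥)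
    (he : 2 ≤ Module.finrank (ResidueField R) (CotangentSpace R))
    (G : ModuleCat.{u} R) (h : ExtVanishes R G (ModuleCat.of R R) 2) : Module.Free R G := by
  obtain ⟨P₁, P₀, _, _, _, _, _, _, d, π, hπ, hd, hext⟩ := aux_ext R G h
  rcases aux_retract R hm2 G P₀ π hπ with hfree | ⟨v, hv, t, ht⟩
  · exact hfree
  exfalso
  refine aux_noext R hm2 he fun φ => ?_
  have hdm : ∀ x, d x ∈ LinearMap.ker π := fun x => hd ▸ LinearMap.mem_range_self d x
  obtain ⟨p, hp⟩ : ∃ p, d p = v := by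
    exact LinearMap.mem_range.1 (hd.symm.le v.2)
  let d' : P₁ →ₗ[R] LinearMap.ker π := LinearMap.codRestrict _ d hdm
  have hd'p : d' p = v := Subtype.ext hp
  obtain ⟨τ, hτ⟩ := Module.projective_lifting_property
    (Algebra.linearMap R (ResidueField R)) (t ∘ₗ d') residue_surjective
  have hτ' : ∀ x, residue R (τ x) = t (d' x) := fun x => LinearMap.congr_fun hτ x
  let τ' : LinearMap.ker d →ₗ[R] maximalIdeal R :=
    LinearMap.codRestrict (maximalIdeal R) (τ ∘ₗ (LinearMap.ker d).subtype) (by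
      rintro ⟨x, hx⟩
      have h0 : d' x = 0 := Subtype.ext hx
      have := hτ' x
      rw [h0, map_zero, residue_eq_zero_iff] at this
      exact this)
  have hp1 : τ p - 1 ∈ maximalIdeal R := by
    rw [← residue_eq_zero_iff, map_sub, hτ', hd'p, ht, map_one, sub_self]
  obtain ⟨ψ, hψ⟩ := hext (φ ∘ₗ τ')
  refine ⟨ψ p, fun z => ?_⟩
  have hzp : (z : R) • p ∈ LinearMap.ker d := by
    rw [LinearMap.mem_ker, map_smul, hp, ← Submodule.coe_smul, hv _ z.2]
    rfl
  have h1 := hψ ⟨_, hzp⟩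
  have h2 : τ' ⟨_, hzp⟩ = z := by
    apply Subtype.ext
    change τ ((z : R) • p) = z
    rw [map_smul, smul_eq_mul]
    have := aux_mul R hm2 z.2 hp1
    rw [mul_sub, sub_eq_zero, mul_one] at this
    exact this
  rw [LinearMap.comp_apply, h2] at h1
  rw [← h1, map_smul, smul_eq_mul, mul_comm]

open IsLocalRing in
theorem aux_no_retract_free (R : Type u) [CommRing R] [IsNoetherianRing R] [IsLocalRing R]
    (hne : ∃ y ∈ maximalIdeal R, y ≠ 0)
    (S : Type u) [AddCommGroup S] [Module R S] [Module.Free R S]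
    (v : S) (hv : ∀ a ∈ maximalIdeal R, a • v = 0) (t : S →ₗ[R] ResidueField R) :
    t v = 0 := by
  obtain ⟨y, hy, hy0⟩ := hne
  let b := Module.Free.chooseBasis R S
  have hc : ∀ i, b.repr v i ∈ maximalIdeal R := by
    intro i
    by_contra hi
    have hu : IsUnit (b.repr v i) := by
      by_contra h
      exact hi ((mem_maximalIdeal _).2 h)
    have : b.repr (y • v) i = 0 := by rw [hv y hy]; simp
    rw [map_smul, Finsupp.smul_apply, smul_eq_mul, hu.mul_left_eq_zero] at this
    exact hy0 this
  rw [← b.linearCombination_repr v, Finsupp.linearCombination_apply, map_finsuppSum]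
  refine Finset.sum_eq_zero fun i _ => ?_
  change t (b.repr v i • b i) = 0
  rw [map_smul, aux_smul_res R (hc i)]

open IsLocalRing in
theorem aux_free_of_resolved (R : Type u) [CommRing R] [IsNoetherianRing R] [IsLocalRing R]
    (hm2 : (maximalIdeal R) ^ 2 = ⊥)
    (he : 2 ≤ Module.finrank (ResidueField R) (CotangentSpace R)) (n : ℕ) :
    ∀ M : ModuleCat.{u} R, ResolvedBy R (IsTotallyReflexive R) n M → Module.Free R M := by
  induction n with
  | zero =>
    rintro M ⟨G, hG, ⟨e⟩⟩
    have := aux_free_of_ext R hm2 he G (hG.2 2 (by norm_num)).1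
    exact Module.Free.of_equiv e
  | succ n ih =>
    rintro M ⟨G, S, hG, ⟨f, g, hf, hg, hfg⟩, hS⟩
    have := aux_free_of_ext R hm2 he G (hG.2 2 (by norm_num)).1
    have hS := ih S hS
    rcases aux_retract R hm2 M G g hg with hfree | ⟨v, hv, t, ht⟩
    · exact hfree
    exfalso
    let e : S ≃ₗ[R] LinearMap.ker g :=
      (LinearEquiv.ofInjective f hf).trans (LinearEquiv.ofEq _ _ hfg)
    have : Module.Free R (LinearMap.ker g) := Module.Free.of_equiv e
    have h0 := aux_no_retract_free R (aux_exists_ne R hm2 he) (LinearMap.ker g) v hv t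
    rw [ht] at h0
    exact one_ne_zero h0

open IsLocalRing in
/-- A finitely generated module embedding in a free module of finite rank. -/
theorem aux_sub (R : Type u) [CommRing R] [IsNoetherianRing R] [IsLocalRing R] (n : ℕ) :
    (maximalIdeal R) ^ 2 = ⊥ → ∀ (M : Type u) [AddCommGroup M] [Module R M]
    [Module.Finite R M] (f : M →ₗ[R] (Fin n → R)), Function.Injective f →
    ∃ α β : ℕ, Nonempty (M ≃ₗ[R] (Fin α → R) × (Fin β → ResidueField R)) := by
  intro hm2
  induction n with
  | zero =>
    intro M _ _ _ f hf
    refine ⟨0, 0, ⟨LinearEquiv.ofBijective 0 ⟨?_, fun y => ⟨0, Subsingleton.elim _ _⟩⟩⟩⟩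
    intro x y _
    exact hf (Subsingleton.elim _ _)
  | succ n ih =>
    intro M _ _ _ f hf
    by_cases hcase : ∃ x i, IsUnit (f x i)
    · obtain ⟨x, i, hu⟩ := hcase
      let c : M →ₗ[R] R := LinearMap.proj i ∘ₗ f
      have hcs : Function.Surjective c := by
        intro r
        refine ⟨(r * ↑hu.unit⁻¹) • x, ?_⟩
        rw [map_smul, smul_eq_mul, mul_assoc]
        change r * (↑hu.unit⁻¹ * f x i) = r
        rw [hu.val_inv_mul, mul_one]
      let f' : LinearMap.ker c →ₗ[R] (Fin n → R) :=
        (LinearMap.funLeft R R i.succAbove) ∘ₗ f ∘ₗ (LinearMap.ker c).subtype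
      have hf' : Function.Injective f' := by
        rw [injective_iff_map_eq_zero]
        rintro ⟨z, hz⟩ h
        apply Subtype.ext
        apply hf
        change f z = f 0
        rw [map_zero]
        funext j
        rcases Fin.eq_self_or_eq_succAbove i j with rfl | ⟨j, rfl⟩
        · exact hz
        · exact congrFun h j
      obtain ⟨α, β, ⟨e⟩⟩ := ih (LinearMap.ker c) f' hf'
      obtain ⟨s, hs⟩ := Module.projective_lifting_property c LinearMap.id hcs
      have hs' : ∀ r, c (s r) = r := fun r => LinearMap.congr_fun hs r
      let F : R × LinearMap.ker c →ₗ[R] M := s.coprod (LinearMap.ker c).subtype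
      have hF : Function.Bijective F := by
        constructor
        · rw [injective_iff_map_eq_zero]
          rintro ⟨r, k, hk⟩ h
          have h1 : s r + k = 0 := by simpa [F] using h
          have h2 : r = 0 := by
            have := congrArg c h1
            rw [map_add, hs', LinearMap.mem_ker.1 hk, map_zero, add_zero] at this
            exact this
          subst h2
          rw [map_zero, zero_add] at h1
          subst h1
          rfl
        · intro z
          refine ⟨(c z, ⟨z - s (c z), ?_⟩), ?_⟩
          · rw [LinearMap.mem_ker, map_sub, hs', sub_self]
          · simp [F]
      refine ⟨α + 1, β, ⟨?_⟩⟩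
      exact (LinearEquiv.ofBijective F hF).symm ≪≫ₗ
        (LinearEquiv.refl R R).prodCongr e ≪≫ₗ
        (LinearEquiv.prodAssoc R R (Fin α → R) (Fin β → ResidueField R)).symm ≪≫ₗ
        (Fin.consLinearEquiv R (fun _ : Fin (α + 1) => R)).prodCongr (LinearEquiv.refl R _)
    · push Not at hcase
      have hkill : ∀ a ∈ maximalIdeal R, ∀ x : M, a • x = 0 := by
        intro a ha x
        apply hf
        rw [map_smul, map_zero]
        funext i
        exact aux_mul R hm2 ha ((mem_maximalIdeal _).2 (hcase x i))
      have htor : Module.IsTorsionBySet R M (maximalIdeal R) := fun x a => hkill a a.2 x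
      let _ : Module (ResidueField R) M := htor.module
      have : IsScalarTower R (ResidueField R) M := htor.isScalarTower
      have : Module.Finite (ResidueField R) M := Module.Finite.of_restrictScalars_finite R _ _
      let b := Module.finBasis (ResidueField R) M
      refine ⟨0, Module.finrank (ResidueField R) M, ⟨?_⟩⟩
      exact (b.equivFun.restrictScalars R) ≪≫ₗ LinearEquiv.uniqueProd.symm

theorem structure_of_finiteRedGdim_of_maximalIdeal_sq_zero
    (R : Type u) [CommRing R] [IsNoetherianRing R] [IsLocalRing R]
    (hm2 : (IsLocalRing.maximalIdeal R) ^ 2 = ⊥)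
    (he : 2 ≤ Module.finrank (IsLocalRing.ResidueField R) (IsLocalRing.CotangentSpace R))
    (M : ModuleCat.{u} R) (hM : Module.Finite R M)
    (hred : FiniteRedGdim R M) :
    ∃ α β : ℕ,
      Nonempty ((M : Type u) ≃ₗ[R] (Fin α → R) × (Fin β → IsLocalRing.ResidueField R)) := by
  obtain ⟨r, K, rfl, ⟨hfin, a, b, n, ha, -, -, hseq⟩, g, hg⟩ := hred
  have hfree := aux_free_of_resolved R hm2 he g _ hg
  have hemb : ∀ i : Fin (r + 1), ∃ f : K 0 →ₗ[R] K i, Function.Injective f := by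
    intro i
    induction i using Fin.induction with
    | zero => exact ⟨LinearMap.id, fun _ _ h => h⟩
    | succ i ih =>
      obtain ⟨f, hf⟩ := ih
      obtain ⟨S, -, f', g', hf', -, -⟩ := hseq i
      let D : K i.castSucc →ₗ[R] MPow R (K i.castSucc) (a i) :=
        LinearMap.pi fun _ : Fin (a i) => LinearMap.id
      have hD : Function.Injective D := fun x y h => congrFun h ⟨0, ha i⟩
      exact ⟨f' ∘ₗ D ∘ₗ f, hf'.comp (hD.comp hf)⟩
  obtain ⟨f, hf⟩ := hemb (Fin.last r)
  have := hfin (Fin.last r)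
  let e := (Module.finBasis R (K (Fin.last r))).equivFun
  exact aux_sub R _ hm2 (K 0) (e.toLinearMap ∘ₗ f) (e.injective.comp hf)
end

section
/- Let R be a commutative Noetherian local ring and M a finitely generated R-module with Ext^i_R(M,R) = 0 for all i ≥ 1. If K_0 = M, K_1, …, K_r is a reducing sequence for M, then Ext^i_R(K_j, R) = 0 for all i ≥ 1 and all j = 0, …, r. -/
open CategoryTheory

universe u

variable (R : Type u) [CommRing R]

section Helpers

open CategoryTheory.Abelian

/-- Vanishing of `Ext` in terms of a projective resolution. -/
lemma extVanishes_iff_res {M N : ModuleCat.{u} R} (P : ProjectiveResolution M) (n : ℕ) :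
    ExtVanishes R M N (n + 1) ↔
      ∀ f : P.complex.X (n + 1) ⟶ N, P.complex.d (n + 2) (n + 1) ≫ f = 0 →
        ∃ g : P.complex.X n ⟶ N, P.complex.d (n + 1) n ≫ g = f := by
  unfold ExtVanishes
  rw [← ModuleCat.isZero_iff_subsingleton,
    (P.isoExt (R := R) (n + 1) N).isZero_iff,
    ← HomologicalComplex.exactAt_iff_isZero_homology,
    HomologicalComplex.exactAt_iff' _ n (n + 1) (n + 2) (by simp) (by simp),
    ShortComplex.moduleCat_exact_iff]
  rfl

lemma ext_subsingleton_iff_res {M N : ModuleCat.{u} R} (P : ProjectiveResolution M) (n : ℕ) :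
    Subsingleton (Abelian.Ext.{u} M N (n + 1)) ↔
      ∀ f : P.complex.X (n + 1) ⟶ N, P.complex.d (n + 2) (n + 1) ≫ f = 0 →
        ∃ g : P.complex.X n ⟶ N, P.complex.d (n + 1) n ≫ g = f := by
  constructor
  · intro h f hf
    exact (P.extMk_eq_zero_iff f (n + 2) rfl hf n rfl).1 (Subsingleton.elim _ _)
  · intro h
    refine subsingleton_of_forall_eq 0 fun x => ?_
    obtain ⟨f, hf, rfl⟩ := P.extMk_surjective x (n + 2) rfl
    exact (P.extMk_eq_zero_iff f (n + 2) rfl hf n rfl).2 (h f hf)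

lemma extVanishes_iff (M N : ModuleCat.{u} R) (n : ℕ) :
    ExtVanishes R M N (n + 1) ↔ Subsingleton (Abelian.Ext.{u} M N (n + 1)) :=
  (extVanishes_iff_res R (ProjectiveResolution.of M) n).trans
    (ext_subsingleton_iff_res R (ProjectiveResolution.of M) n).symm

/-- All positive `Ext`s into `N` vanish. -/
def AllVan (N M : ModuleCat.{u} R) : Prop :=
  ∀ n : ℕ, ∀ x : Abelian.Ext.{u} M N (n + 1), x = 0

variable {R}

lemma SES.shortExact {A B C : ModuleCat.{u} R} (h : SES R A B C) :
    ∃ (f : A ⟶ B) (g : B ⟶ C) (w : f ≫ g = 0), (ShortComplex.mk f g w).ShortExact := by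
  obtain ⟨f, g, hf, hg, e⟩ := h
  have w : ModuleCat.ofHom f ≫ ModuleCat.ofHom g = 0 := by
    ext x
    have : f x ∈ LinearMap.ker g := e ▸ LinearMap.mem_range_self f x
    simpa using this
  refine ⟨ModuleCat.ofHom f, ModuleCat.ofHom g, w, ?_⟩
  have h₁ : Mono (ModuleCat.ofHom f) := (ModuleCat.mono_iff_injective _).2 hf
  have : Epi (ModuleCat.ofHom g) := (ModuleCat.epi_iff_surjective _).2 hg
  exact { exact := (ShortComplex.moduleCat_exact_iff_range_eq_ker _).2 e
          mono_f := h₁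
          epi_g := this }

lemma AllVan.of_ses {N A B C : ModuleCat.{u} R} (h : SES R A B C)
    (hA : AllVan R N A) (hC : AllVan R N C) : AllVan R N B := by
  obtain ⟨f, g, w, hS⟩ := h.shortExact
  intro n x
  obtain ⟨y, rfl⟩ := Abelian.Ext.contravariant_sequence_exact₂ hS N x (hA n _)
  rw [hC n y, Abelian.Ext.comp_zero]

lemma AllVan.of_projective (N P : ModuleCat.{u} R) [Module.Projective R P] : AllVan R N P := by
  intro n x
  have : Projective P := (IsProjective.iff_projective P).1 inferInstance
  exact Abelian.Ext.eq_zero_of_projective x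

lemma AllVan.of_ses_left {N A B C : ModuleCat.{u} R} (h : SES R A B C)
    (hB : AllVan R N B) (hC : AllVan R N C) : AllVan R N A := by
  obtain ⟨f, g, w, hS⟩ := h.shortExact
  intro n x
  obtain ⟨y, rfl⟩ := Abelian.Ext.contravariant_sequence_exact₁ hS N x (n₁ := n + 1 + 1)
    (by omega) (hC (n + 1) _)
  rw [hB n y, Abelian.Ext.comp_zero]

lemma AllVan.of_equiv {N A B : ModuleCat.{u} R} (e : A ≃ₗ[R] B) (hB : AllVan R N B) :
    AllVan R N A := by
  refine AllVan.of_ses (C := ModuleCat.of R PUnit) (A := B)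
    ⟨e.symm.toLinearMap, 0, e.symm.injective, fun y => ⟨0, Subsingleton.elim _ _⟩, ?_⟩ hB
    (AllVan.of_projective _ _)
  rw [LinearMap.ker_zero, LinearEquiv.range]

lemma AllVan.syzygy {N K : ModuleCat.{u} R} (hK : AllVan R N K) :
    ∀ (n : ℕ) (S : ModuleCat.{u} R), IsSyzygy R n S K → AllVan R N S
  | 0, _, ⟨e⟩ => hK.of_equiv e
  | n + 1, _, ⟨T, F, hT, hF, hs⟩ => by
    have := hF.2
    exact AllVan.of_ses_left hs (AllVan.of_projective N F) (hK.syzygy n T hT)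

lemma pow_seq (R K : Type u) [CommRing R] [AddCommGroup K] [Module R K] (a : ℕ) :
    ∃ (f : K →ₗ[R] (Fin (a + 1) → K)) (g : (Fin (a + 1) → K) →ₗ[R] (Fin a → K)),
      Function.Injective f ∧ Function.Surjective g ∧ LinearMap.range f = LinearMap.ker g := by
  refine ⟨LinearMap.single R (fun _ : Fin (a + 1) => K) 0,
    LinearMap.funLeft R K Fin.succ, ?_, ?_, ?_⟩
  · intro x y h
    simpa using congrFun h 0
  · exact LinearMap.funLeft_surjective_of_injective R K _ (Fin.succ_injective _)
  · ext x
    rw [LinearMap.mem_range, LinearMap.mem_ker]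
    constructor
    · rintro ⟨y, rfl⟩
      funext i
      simp [LinearMap.funLeft_apply]
    · intro hx
      refine ⟨x 0, ?_⟩
      funext i
      refine Fin.cases ?_ (fun j => ?_) i
      · simp
      · have := congrFun hx j
        simp only [LinearMap.funLeft_apply, Pi.zero_apply] at this
        simp [this]

lemma AllVan.mPow {N K : ModuleCat.{u} R} (hK : AllVan R N K) (a : ℕ) :
    AllVan R N (MPow R K a) := by
  induction a with
  | zero =>
    have : Module.Projective R (MPow R K 0) :=
      inferInstanceAs (Module.Projective R (Fin 0 → K))
    exact AllVan.of_projective _ _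
  | succ a ih =>
    obtain ⟨f, g, hf, hg, e⟩ := pow_seq R K a
    exact AllVan.of_ses (A := K) (C := MPow R K a) ⟨f, g, hf, hg, e⟩ hK ih

end Helpers

theorem ext_vanishing_along_reducing_seq
    (R : Type u) [CommRing R] [IsNoetherianRing R] [IsLocalRing R]
    (M : ModuleCat.{u} R) (hM : Module.Finite R M)
    (hext : ∀ i : ℕ, 1 ≤ i → ExtVanishes R M (ModuleCat.of R R) i)
    (r : ℕ) (K : Fin (r + 1) → ModuleCat.{u} R)
    (hK0 : K 0 = M) (hK : IsReducingSeq R K) :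
    ∀ (j : Fin (r + 1)) (i : ℕ), 1 ≤ i → ExtVanishes R (K j) (ModuleCat.of R R) i := by
  obtain ⟨-, a, b, n, -, -, -, h⟩ := hK
  have key : ∀ j, AllVan R (ModuleCat.of R R) (K j) := by
    intro j
    induction j using Fin.induction with
    | zero =>
      intro n x
      have := (extVanishes_iff R M (ModuleCat.of R R) n).1 (hext (n + 1) (by omega))
      rw [← hK0] at this
      exact Subsingleton.elim _ _
    | succ i ih =>
      obtain ⟨S, hS, hs⟩ := h i
      exact AllVan.of_ses hs (ih.mPow _) ((ih.mPow _).syzygy _ _ hS)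
  intro j i hi
  obtain ⟨m, rfl⟩ : ∃ m, i = m + 1 := ⟨i - 1, by omega⟩
  exact (extVanishes_iff R _ _ m).2 (subsingleton_of_forall_eq 0 (key j m))
end
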